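/- For all x⃗, y⃗ ∈ ℝ³ and all x₄ > 0, y₄ > 0, the value f₂((0,x⃗) − i(x₄,0), (0,y⃗) − i(y₄,0)) equals the iterated Euclidean integral (2π)^{−8} ∫_{ℝ³} ∫_{ℝ} ∫_{ℝ³} ∫_{ℝ} e^{i(⟨k, x⃗⟩ + k₄ x₄ + ⟨p, y⃗⟩ + p₄ y₄)} / ( (|k|² + k₄² + m²)(|p|² + p₄² + m²) ) dk₄ dk dp₄ dp, where all iterated integrals converge absolutely in the indicated order. This identifies the Schwinger function s₂(x, y) associated with the tensor product of two two-point functions, for x₄, y₄ > 0. -/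

import Mathlib

open MeasureTheory

/-- The on-shell energy `ω(k) = √(|k|² + m²)` for `k ∈ ℝ³`. -/
noncomputable def omega (m : ℝ) (k : Fin 3 → ℝ) : ℝ :=
  Real.sqrt ((∑ i, k i ^ 2) + m ^ 2)

/-- The analytic function `f₂(z, w)` whose boundary value is `Δ₊⁽²⁾`. -/
noncomputable def f₂Ana (m : ℝ) (z w : ℂ × (Fin 3 → ℂ)) : ℂ :=
  ((((2 * Real.pi) ^ 6)⁻¹ : ℝ) : ℂ) *
    ∫ kp : (Fin 3 → ℝ) × (Fin 3 → ℝ),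
      Complex.exp (-Complex.I * (omega m kp.1 : ℂ) * z.1 +
          Complex.I * ∑ i, (kp.1 i : ℂ) * z.2 i) *
        Complex.exp (-Complex.I * (omega m kp.2 : ℂ) * w.1 +
          Complex.I * ∑ i, (kp.2 i : ℂ) * w.2 i) /
        (4 * (omega m kp.1 : ℂ) * (omega m kp.2 : ℂ))

/-- The Euclidean integrand
`e^{i(⟨k,x⃗⟩ + k₄x₄ + ⟨p,y⃗⟩ + p₄y₄)} / ((|k|²+k₄²+m²)(|p|²+p₄²+m²))`. -/
noncomputable def eucInt (m : ℝ) (xv : Fin 3 → ℝ) (x₄ : ℝ) (yv : Fin 3 → ℝ) (y₄ : ℝ)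
    (p : Fin 3 → ℝ) (p₄ : ℝ) (k : Fin 3 → ℝ) (k₄ : ℝ) : ℂ :=
  Complex.exp (Complex.I *
      (((∑ i, k i * xv i) + k₄ * x₄ + (∑ i, p i * yv i) + p₄ * y₄ : ℝ) : ℂ)) /
    (((((∑ i, k i ^ 2) + k₄ ^ 2 + m ^ 2) * ((∑ i, p i ^ 2) + p₄ ^ 2 + m ^ 2) : ℝ) : ℂ))


/-- The Fourier transform of the two-sided exponential `t ↦ e^{-a|t|}`. -/
lemma integrable_and_integral_exp_sub_abs {a : ℝ} (ha : 0 < a) (x : ℝ) :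
    Integrable (fun t : ℝ => Complex.exp (Complex.I * (x * t : ℝ) - (a * |t| : ℝ))) ∧
    ∫ t : ℝ, Complex.exp (Complex.I * (x * t : ℝ) - (a * |t| : ℝ)) =
      ((2 * a / (a ^ 2 + x ^ 2) : ℝ) : ℂ) := by
  have h1 : Set.EqOn (fun t : ℝ => Complex.exp ((Complex.I * x + a) * t))
      (fun t : ℝ => Complex.exp (Complex.I * (x * t : ℝ) - (a * |t| : ℝ))) (Set.Iic 0) := by
    intro t (ht : t ≤ 0)
    simp only [abs_of_nonpos ht]
    congr 1; push_cast; ring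
  have h2 : Set.EqOn (fun t : ℝ => Complex.exp ((Complex.I * x - a) * t))
      (fun t : ℝ => Complex.exp (Complex.I * (x * t : ℝ) - (a * |t| : ℝ))) (Set.Ioi 0) := by
    intro t (ht : 0 < t)
    simp only [abs_of_pos ht]
    congr 1; push_cast; ring
  have r1 : 0 < (Complex.I * x + a : ℂ).re := by simpa using ha
  have r2 : (Complex.I * x - a : ℂ).re < 0 := by simpa using ha
  have i1 := (integrableOn_exp_mul_complex_Iic r1 0).congr_fun h1 measurableSet_Iic
  have i2 := (integrableOn_exp_mul_complex_Ioi r2 0).congr_fun h2 measurableSet_Ioi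
  constructor
  · rw [← integrableOn_univ, ← Set.Iic_union_Ioi (a := (0 : ℝ))]
    exact i1.union i2
  · rw [← intervalIntegral.integral_Iic_add_Ioi i1 i2,
      ← setIntegral_congr_fun measurableSet_Iic h1, ← setIntegral_congr_fun measurableSet_Ioi h2,
      integral_exp_mul_complex_Iic r1, integral_exp_mul_complex_Ioi r2]
    have n1 : (Complex.I * x + a : ℂ) ≠ 0 := fun h => by rw [h] at r1; simp at r1
    have n2 : (Complex.I * x - a : ℂ) ≠ 0 := fun h => by rw [h] at r2; simp at r2
    have n3 : (a ^ 2 + x ^ 2 : ℂ) ≠ 0 := by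
      exact_mod_cast (by positivity : (a ^ 2 + x ^ 2 : ℝ) ≠ 0)
    push_cast
    simp only [mul_zero, Complex.exp_zero]
    field_simp
    linear_combination (-2 * a * x ^ 2) * Complex.I_sq

/-- The Cauchy kernel, multiplied by a character, is integrable. -/
lemma integrable_exp_div_sq_add_sq {a : ℝ} (ha : 0 < a) (x : ℝ) :
    Integrable (fun t : ℝ => Complex.exp (Complex.I * (t * x : ℝ)) / ((t ^ 2 + a ^ 2 : ℝ) : ℂ)) := by
  have h : Integrable (fun t : ℝ => (a ^ 2)⁻¹ * (1 + (t / a) ^ 2)⁻¹) :=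
    (integrable_inv_one_add_sq.comp_div ha.ne').const_mul _
  refine h.mono' (by
    apply Measurable.aestronglyMeasurable; fun_prop) (.of_forall fun t => ?_)
  rw [norm_div, mul_comm Complex.I, Complex.norm_exp_ofReal_mul_I, Complex.norm_real,
    Real.norm_of_nonneg (by positivity)]
  apply le_of_eq
  field_simp
  ring

open scoped FourierTransform in
/-- The Fourier transform of the Cauchy kernel. -/
lemma integral_exp_div_sq_add_sq {a : ℝ} (ha : 0 < a) {x : ℝ} (hx : 0 ≤ x) :
    ∫ t : ℝ, Complex.exp (Complex.I * (t * x : ℝ)) / ((t ^ 2 + a ^ 2 : ℝ) : ℂ) =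
      ((Real.pi / a * Real.exp (-a * x) : ℝ) : ℂ) := by
  let f : ℝ → ℂ := fun t => Complex.exp (-(a * |t| : ℝ))
  have hf : Integrable f := by
    simpa [f] using (integrable_and_integral_exp_sub_abs ha 0).1
  have hF : 𝓕 f = fun w : ℝ => ((2 * a / (a ^ 2 + (2 * Real.pi * w) ^ 2) : ℝ) : ℂ) := by
    ext w
    have := (integrable_and_integral_exp_sub_abs ha (-2 * Real.pi * w)).2
    rw [Real.fourier_real_eq_integral_exp_smul]
    rw [show (2 * Real.pi * w) ^ 2 = (-2 * Real.pi * w) ^ 2 by ring, ← this]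
    congr 1 with t
    rw [smul_eq_mul, ← Complex.exp_add]
    congr 1; push_cast; ring
  have hFi : Integrable (𝓕 f) := by
    have := ((integrable_exp_div_sq_add_sq ha 0).comp_mul_left'
      (mul_ne_zero two_ne_zero Real.pi_ne_zero)).const_mul (2 * a : ℂ)
    rw [hF]
    refine this.congr (.of_forall fun w => ?_)
    simp [add_comm, div_eq_mul_inv]
  have inv := congrFun (Continuous.fourierInv_fourier_eq (by fun_prop) hf hFi) x
  rw [hF, Real.fourierInv_eq'] at inv
  have cv := Measure.integral_comp_mul_left (fun t : ℝ => Complex.exp (Complex.I * (t * x : ℝ)) /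
    ((t ^ 2 + a ^ 2 : ℝ) : ℂ)) (2 * Real.pi)
  have e : ∀ w : ℝ, Complex.exp (((2 * Real.pi * inner ℝ w x : ℝ) : ℂ) * Complex.I) •
      ((2 * a / (a ^ 2 + (2 * Real.pi * w) ^ 2) : ℝ) : ℂ) =
      (2 * a : ℂ) * (Complex.exp (Complex.I * (2 * Real.pi * w * x : ℝ)) /
        (((2 * Real.pi * w) ^ 2 + a ^ 2 : ℝ) : ℂ)) := by
    intro w
    rw [smul_eq_mul, real_inner_eq_re_inner]
    simp
    ring_nf
  simp_rw [e] at inv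
  rw [integral_const_mul, cv, abs_of_nonneg (by positivity), Complex.real_smul] at inv
  simp only [f, abs_of_nonneg hx] at inv
  generalize (∫ t : ℝ, Complex.exp (Complex.I * (t * x : ℝ)) / ((t ^ 2 + a ^ 2 : ℝ) : ℂ)) = J
    at inv ⊢
  have hac : (a : ℂ) ≠ 0 := by exact_mod_cast ha.ne'
  have hpi : (Real.pi : ℂ) ≠ 0 := by exact_mod_cast Real.pi_ne_zero
  push_cast at inv ⊢
  rw [neg_mul, ← inv]
  field_simp

lemma sq_omega (m : ℝ) (k : Fin 3 → ℝ) : omega m k ^ 2 = (∑ i, k i ^ 2) + m ^ 2 :=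
  Real.sq_sqrt (by positivity)

lemma le_omega {m : ℝ} (k : Fin 3 → ℝ) : m ≤ omega m k :=
  Real.le_sqrt_of_sq_le (le_add_of_nonneg_left (by positivity))

lemma omega_pos {m : ℝ} (hm : 0 < m) (k : Fin 3 → ℝ) : 0 < omega m k :=
  hm.trans_le (le_omega k)

lemma abs_le_omega (m : ℝ) (k : Fin 3 → ℝ) (i : Fin 3) : |k i| ≤ omega m k := by
  refine Real.abs_le_sqrt ?_
  have : k i ^ 2 ≤ ∑ i, k i ^ 2 :=
    Finset.single_le_sum (f := fun i => k i ^ 2) (fun j _ => sq_nonneg _) (Finset.mem_univ i)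
  linarith [sq_nonneg m]

@[fun_prop]
lemma measurable_omega (m : ℝ) : Measurable (omega m) := by
  unfold omega; fun_prop

/-- The three-dimensional on-shell integrand at imaginary time `-i t`, up to normalization. -/
noncomputable def onShell (m : ℝ) (xv : Fin 3 → ℝ) (t : ℝ) (k : Fin 3 → ℝ) : ℂ :=
  Complex.exp (Complex.I * ((∑ i, k i * xv i : ℝ) : ℂ)) *
    ((Real.pi / omega m k * Real.exp (-omega m k * t) : ℝ) : ℂ)

lemma integrable_onShell {m : ℝ} (hm : 0 < m) (xv : Fin 3 → ℝ) {t : ℝ} (ht : 0 < t) :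
    Integrable (onShell m xv t) := by
  have h1 : Integrable (fun s : ℝ => Real.exp (-(t / 3 * |s|))) := by
    have := (integrable_and_integral_exp_sub_abs (a := t / 3) (by positivity) 0).1.norm
    simpa [Complex.norm_exp] using this
  have h2 : Integrable (fun k : Fin 3 → ℝ => Real.pi / m * ∏ i, Real.exp (-(t / 3 * |k i|))) :=
    (Integrable.fintype_prod (μ := fun _ => volume) (fun _ => h1)).const_mul _
  refine h2.mono' ?_ (.of_forall fun k => ?_)
  · apply Measurable.aestronglyMeasurable
    unfold onShell
    fun_prop
  · have hω := omega_pos hm k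
    rw [onShell, norm_mul, mul_comm Complex.I, Complex.norm_exp_ofReal_mul_I, Complex.norm_real,
      Real.norm_of_nonneg (by positivity), one_mul, ← Real.exp_sum]
    gcongr
    · exact le_omega k
    · simp only [Fin.sum_univ_three]
      nlinarith [abs_le_omega m k 0, abs_le_omega m k 1, abs_le_omega m k 2]

/-- The Euclidean propagator in momentum space, multiplied by the time character. -/
noncomputable def timeKernel (m : ℝ) (t : ℝ) (k : Fin 3 → ℝ) (k₄ : ℝ) : ℂ :=
  Complex.exp (Complex.I * (k₄ * t : ℝ)) / ((k₄ ^ 2 + omega m k ^ 2 : ℝ) : ℂ)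

lemma eucInt_eq (m : ℝ) (xv : Fin 3 → ℝ) (x₄ : ℝ) (yv : Fin 3 → ℝ) (y₄ : ℝ)
    (p : Fin 3 → ℝ) (p₄ : ℝ) (k : Fin 3 → ℝ) (k₄ : ℝ) :
    eucInt m xv x₄ yv y₄ p p₄ k k₄ =
      (Complex.exp (Complex.I * ((∑ i, p i * yv i : ℝ) : ℂ)) * timeKernel m y₄ p p₄) *
        (Complex.exp (Complex.I * ((∑ i, k i * xv i : ℝ) : ℂ)) * timeKernel m x₄ k k₄) := by
  have e1 : (∑ i, k i ^ 2) + k₄ ^ 2 + m ^ 2 = k₄ ^ 2 + omega m k ^ 2 := by rw [sq_omega]; ring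
  have e2 : (∑ i, p i ^ 2) + p₄ ^ 2 + m ^ 2 = p₄ ^ 2 + omega m p ^ 2 := by rw [sq_omega]; ring
  rw [eucInt, e1, e2, timeKernel, timeKernel, Complex.ofReal_add, Complex.ofReal_add,
    Complex.ofReal_add, mul_add, mul_add, mul_add, Complex.exp_add, Complex.exp_add,
    Complex.exp_add,
    Complex.ofReal_mul (k₄ ^ 2 + omega m k ^ 2)]
  ring

lemma integral_character_mul_timeKernel {m : ℝ} (hm : 0 < m) (xv : Fin 3 → ℝ) {t : ℝ} (ht : 0 ≤ t)
    (k : Fin 3 → ℝ) :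
    ∫ k₄ : ℝ, Complex.exp (Complex.I * ((∑ i, k i * xv i : ℝ) : ℂ)) * timeKernel m t k k₄ =
      onShell m xv t k := by
  simp only [timeKernel, onShell]
  rw [integral_const_mul, integral_exp_div_sq_add_sq (omega_pos hm k) ht]

lemma integrable_character_mul_timeKernel {m : ℝ} (hm : 0 < m) (xv : Fin 3 → ℝ) (t : ℝ)
    (k : Fin 3 → ℝ) :
    Integrable (fun k₄ : ℝ =>
      Complex.exp (Complex.I * ((∑ i, k i * xv i : ℝ) : ℂ)) * timeKernel m t k k₄) :=
  (integrable_exp_div_sq_add_sq (omega_pos hm k) t).const_mul _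

/-- At Euclidean points, `f₂Ana` is a product of two on-shell integrals. -/
lemma f₂Ana_euclidean {m : ℝ} (hm : 0 < m) (xv yv : Fin 3 → ℝ) (x₄ y₄ : ℝ) :
    f₂Ana m (((0 : ℝ) : ℂ) - Complex.I * (x₄ : ℂ), fun i => ((xv i : ℝ) : ℂ))
        (((0 : ℝ) : ℂ) - Complex.I * (y₄ : ℂ), fun i => ((yv i : ℝ) : ℂ)) =
      ((((2 * Real.pi) ^ 8)⁻¹ : ℝ) : ℂ) *
        ((∫ k, onShell m xv x₄ k) * ∫ p, onShell m yv y₄ p) := by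
  have hpi : (Real.pi : ℂ) ≠ 0 := by exact_mod_cast Real.pi_ne_zero
  have e : ∀ kp : (Fin 3 → ℝ) × (Fin 3 → ℝ),
      Complex.exp (-Complex.I * (omega m kp.1 : ℂ) * (((0 : ℝ) : ℂ) - Complex.I * (x₄ : ℂ)) +
          Complex.I * ∑ i, (kp.1 i : ℂ) * (xv i : ℂ)) *
        Complex.exp (-Complex.I * (omega m kp.2 : ℂ) * (((0 : ℝ) : ℂ) - Complex.I * (y₄ : ℂ)) +
          Complex.I * ∑ i, (kp.2 i : ℂ) * (yv i : ℂ)) /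
        (4 * (omega m kp.1 : ℂ) * (omega m kp.2 : ℂ)) =
      (4 * (Real.pi : ℂ) ^ 2)⁻¹ * (onShell m xv x₄ kp.1 * onShell m yv y₄ kp.2) := by
    intro kp
    have h1 : (omega m kp.1 : ℂ) ≠ 0 := by exact_mod_cast (omega_pos hm _).ne'
    have h2 : (omega m kp.2 : ℂ) ≠ 0 := by exact_mod_cast (omega_pos hm _).ne'
    have ph : ∀ a b : ℂ, -Complex.I * a * (((0 : ℝ) : ℂ) - Complex.I * b) = -a * b := by
      intro a b
      rw [Complex.ofReal_zero]
      linear_combination (a * b) * Complex.I_sq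
    rw [ph, ph, Complex.exp_add, Complex.exp_add, onShell, onShell]
    push_cast
    field_simp
  rw [f₂Ana]
  simp only [e]
  rw [integral_const_mul, Measure.volume_eq_prod, integral_prod_mul]
  push_cast
  field_simp
  norm_num

/-- For `x₄, y₄ > 0`, the value `f₂((0,x⃗) − i(x₄,0), (0,y⃗) − i(y₄,0))` equals the
iterated Euclidean integral
`(2π)⁻⁸ ∫_{ℝ³}∫_ℝ∫_{ℝ³}∫_ℝ e^{i(⟨k,x⃗⟩+k₄x₄+⟨p,y⃗⟩+p₄y₄)} /((|k|²+k₄²+m²)(|p|²+p₄²+m²)) dk₄ dk dp₄ dp`,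
all iterated integrals converging absolutely in the indicated order. This identifies
the Schwinger function `s₂(x, y)` for `x₄, y₄ > 0`. -/
theorem schwinger_function_s₂ (m : ℝ) (hm : 0 < m)
    (xv yv : Fin 3 → ℝ) (x₄ y₄ : ℝ) (hx₄ : 0 < x₄) (hy₄ : 0 < y₄) :
    (∀ (p : Fin 3 → ℝ) (p₄ : ℝ) (k : Fin 3 → ℝ),
      Integrable (fun k₄ : ℝ => eucInt m xv x₄ yv y₄ p p₄ k k₄)) ∧
    (∀ (p : Fin 3 → ℝ) (p₄ : ℝ),
      Integrable (fun k : Fin 3 → ℝ => ∫ k₄ : ℝ, eucInt m xv x₄ yv y₄ p p₄ k k₄)) ∧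
    (∀ p : Fin 3 → ℝ,
      Integrable (fun p₄ : ℝ =>
        ∫ k : Fin 3 → ℝ, ∫ k₄ : ℝ, eucInt m xv x₄ yv y₄ p p₄ k k₄)) ∧
    Integrable (fun p : Fin 3 → ℝ =>
      ∫ p₄ : ℝ, ∫ k : Fin 3 → ℝ, ∫ k₄ : ℝ, eucInt m xv x₄ yv y₄ p p₄ k k₄) ∧
    f₂Ana m (((0 : ℝ) : ℂ) - Complex.I * (x₄ : ℂ), fun i => ((xv i : ℝ) : ℂ))
          (((0 : ℝ) : ℂ) - Complex.I * (y₄ : ℂ), fun i => ((yv i : ℝ) : ℂ)) =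
      ((((2 * Real.pi) ^ 8)⁻¹ : ℝ) : ℂ) *
        ∫ p : Fin 3 → ℝ, ∫ p₄ : ℝ, ∫ k : Fin 3 → ℝ, ∫ k₄ : ℝ,
          eucInt m xv x₄ yv y₄ p p₄ k k₄ := by
  have hk₄ : ∀ p p₄ k, ∫ k₄ : ℝ, eucInt m xv x₄ yv y₄ p p₄ k k₄ =
      (Complex.exp (Complex.I * ((∑ i, p i * yv i : ℝ) : ℂ)) * timeKernel m y₄ p p₄) *
        onShell m xv x₄ k := by
    intro p p₄ k
    simp only [eucInt_eq]
    rw [integral_const_mul, integral_character_mul_timeKernel hm xv hx₄.le]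
  have hk : ∀ p p₄, ∫ k : Fin 3 → ℝ, ∫ k₄ : ℝ, eucInt m xv x₄ yv y₄ p p₄ k k₄ =
      (Complex.exp (Complex.I * ((∑ i, p i * yv i : ℝ) : ℂ)) * timeKernel m y₄ p p₄) *
        ∫ k, onShell m xv x₄ k := by
    intro p p₄
    simp only [hk₄]
    rw [integral_const_mul]
  have hp₄ : ∀ p, ∫ p₄ : ℝ, ∫ k : Fin 3 → ℝ, ∫ k₄ : ℝ, eucInt m xv x₄ yv y₄ p p₄ k k₄ =
      onShell m yv y₄ p * ∫ k, onShell m xv x₄ k := by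
    intro p
    simp only [hk]
    rw [integral_mul_const, integral_character_mul_timeKernel hm yv hy₄.le]
  refine ⟨fun p p₄ k => ?_, fun p p₄ => ?_, fun p => ?_, ?_, ?_⟩
  · simp only [eucInt_eq]
    exact (integrable_character_mul_timeKernel hm xv x₄ k).const_mul _
  · simp only [hk₄]
    exact (integrable_onShell hm xv hx₄).const_mul _
  · simp only [hk]
    exact (integrable_character_mul_timeKernel hm yv y₄ p).mul_const _
  · simp only [hp₄]
    exact (integrable_onShell hm yv hy₄).mul_const _
  · simp only [hp₄]
    rw [f₂Ana_euclidean hm, integral_mul_const, mul_comm (∫ p, onShell m yv y₄ p)]
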